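/- The squaring map z ↦ z² maps the ellipse {(X,Y) : (X/a)² + (Y/b)² = 1} (centered at the origin, semi-axes a > b > 0) onto an ellipse with one focus at the origin and minor axis of length 2ab. Consequently, ellipses centered at the origin with fixed area πab are mapped to focal ellipses with fixed minor axis 2ab. -/

import Mathlib

/-- The complex squaring map `z ↦ z²` in real coordinates. -/
def sqMap (p : ℝ × ℝ) : ℝ × ℝ := (p.1 ^ 2 - p.2 ^ 2, 2 * p.1 * p.2)

/-- The squaring map sends the origin-centered ellipse with
semi-axes `a > b > 0` onto the ellipse with center `((a²−b²)/2, 0)`,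
semi-major axis `α = (a²+b²)/2` and semi-minor axis `β = ab`; since
`α² − β² = ((a²−b²)/2)²`, this image ellipse has a focus at the origin,
and its minor axis has length `2ab`. -/
theorem squaring_map_ellipse_to_focal_ellipse (a b : ℝ) (hab : b < a) (hb : 0 < b) :
    sqMap '' {p : ℝ × ℝ | (p.1 / a) ^ 2 + (p.2 / b) ^ 2 = 1}
      = {q : ℝ × ℝ |
          ((q.1 - (a ^ 2 - b ^ 2) / 2) / ((a ^ 2 + b ^ 2) / 2)) ^ 2
            + (q.2 / (a * b)) ^ 2 = 1} ∧
    ((a ^ 2 + b ^ 2) / 2) ^ 2 - (a * b) ^ 2 = ((a ^ 2 - b ^ 2) / 2) ^ 2 := by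
  have ha : 0 < a := hb.trans hab
  have hc : 0 < a ^ 2 + b ^ 2 := by positivity
  refine ⟨?_, by ring⟩
  -- the key identities: in normalised coordinates the map is `(u, v) ↦ (u² - v², 2uv)`
  have key1 : ∀ u v : ℝ, u ^ 2 + v ^ 2 = 1 →
      (a * u) ^ 2 - (b * v) ^ 2 = (a ^ 2 - b ^ 2) / 2 + (a ^ 2 + b ^ 2) / 2 * (u ^ 2 - v ^ 2) := by
    intro u v h
    linear_combination (a ^ 2 - b ^ 2) / 2 * h
  ext ⟨r, s⟩
  simp only [Set.mem_image, Set.mem_setOf_eq, Prod.exists, sqMap, Prod.mk.injEq]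
  constructor
  · rintro ⟨x, y, h, rfl, rfl⟩
    obtain ⟨u, rfl⟩ : ∃ u, x = a * u := ⟨x / a, by field_simp⟩
    obtain ⟨v, rfl⟩ : ∃ v, y = b * v := ⟨y / b, by field_simp⟩
    rw [mul_div_cancel_left₀ _ ha.ne', mul_div_cancel_left₀ _ hb.ne'] at h
    have e2 : 2 * (a * u) * (b * v) / (a * b) = 2 * u * v := by field_simp
    rw [key1 u v h, e2, add_sub_cancel_left, mul_div_cancel_left₀ _ (by positivity)]
    linear_combination (u ^ 2 + v ^ 2 + 1) * h
  · intro h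
    obtain ⟨C, hC⟩ : ∃ C, C = (r - (a ^ 2 - b ^ 2) / 2) / ((a ^ 2 + b ^ 2) / 2) := ⟨_, rfl⟩
    obtain ⟨S, hS⟩ : ∃ S, S = s / (a * b) := ⟨_, rfl⟩
    rw [← hC, ← hS] at h
    rw [eq_div_iff (by positivity)] at hC hS
    obtain ⟨z, hz⟩ := IsAlgClosed.exists_pow_nat_eq (⟨C, S⟩ : ℂ) (n := 2) (by norm_num)
    have h1 : z.re ^ 2 - z.im ^ 2 = C := by
      have := congrArg Complex.re hz
      simp only [pow_two, Complex.mul_re] at this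
      linarith
    have h2 : 2 * z.re * z.im = S := by
      have := congrArg Complex.im hz
      simp only [pow_two, Complex.mul_im] at this
      linarith
    have h3 : z.re ^ 2 + z.im ^ 2 = 1 := by
      have h4 : (z.re ^ 2 + z.im ^ 2) ^ 2 = 1 := by
        rw [← h, ← h1, ← h2]; ring
      have h5 : 0 ≤ z.re ^ 2 + z.im ^ 2 := by positivity
      nlinarith
    refine ⟨a * z.re, b * z.im, ?_, ?_, ?_⟩
    · rw [mul_div_cancel_left₀ _ ha.ne', mul_div_cancel_left₀ _ hb.ne', h3]
    · rw [key1 _ _ h3, h1]; linarith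
    · linear_combination a * b * h2 + hS
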